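/- arXiv:1907.05816 — 2 statements merged into one kernel-verified Lean document; each statement's English description precedes it below -/
import Mathlib

section
/- Fix a constant c > 0 and let 0 < p ≤ 1. There exists a constant C > 0, depending only on c, such that the following holds. Let n ≥ 2 and let Z_1, …, Z_n be real random variables on a common probability space (not necessarily independent) such that for every i ∈ {1,…,n} and every λ > 1, P(|Z_i| > cλ) < λ^{−p}. Let X ∈ ℝ^n have strictly positive entries and set Y_i = Z_i X_i. Then for every λ ≥ 1, P(∑_{i=1}^n |Y_i| ≥ C λ^{1/p} log(nλ) ‖X‖_p) ≤ 1/λ. -/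
open MeasureTheory

/-- Markov's inequality for a sum of truncated nonnegative functions. -/
lemma measure_one_le_sum_le {Ω ι : Type*} [MeasurableSpace Ω] [Fintype ι] (μ : Measure Ω)
    (f : ι → Ω → ℝ) (hf : ∀ i, Measurable (f i)) (hf0 : ∀ i ω, 0 ≤ f i ω) :
    μ {ω | 1 ≤ ∑ i, f i ω} ≤ ∑ i, ∫⁻ ω, ENNReal.ofReal (min (f i ω) 1) ∂μ := by
  have hmin0 : ∀ i ω, 0 ≤ min (f i ω) 1 := fun i ω => le_min (hf0 i ω) zero_le_one
  have hmeas : ∀ i, Measurable fun ω => ENNReal.ofReal (min (f i ω) 1) := fun i =>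
    ((hf i).min measurable_const).ennreal_ofReal
  rw [← lintegral_finsetSum _ fun i _ => hmeas i]
  refine le_trans (measure_mono ?_) (le_trans (le_of_eq (one_mul _).symm)
    (mul_meas_ge_le_lintegral (Finset.measurable_sum _ fun i _ => hmeas i) 1))
  intro ω hω
  simp only [Set.mem_ofPred_eq] at hω ⊢
  rw [← ENNReal.ofReal_sum_of_nonneg fun i _ => hmin0 i ω, ENNReal.one_le_ofReal]
  by_cases h : ∃ i, 1 ≤ f i ω
  · obtain ⟨i, hi⟩ := h
    calc (1 : ℝ) = min (f i ω) 1 := (min_eq_right hi).symm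
      _ ≤ _ := Finset.single_le_sum (f := fun i => min (f i ω) 1)
        (fun j _ => hmin0 j ω) (Finset.mem_univ i)
  · push Not at h
    rwa [Finset.sum_congr rfl fun i _ => min_eq_left (h i).le]

/-- Layer-cake bound for the truncated expectation. -/
lemma lintegral_min_one_le_of_tail {Ω : Type*} [MeasurableSpace Ω] (μ : Measure Ω)
    {f : Ω → ℝ} (hf : Measurable f) (hf0 : ∀ ω, 0 ≤ f ω) {g : ℝ → ENNReal}
    (hg : ∀ u, 0 < u → μ {ω | u < f ω} ≤ g u) :
    ∫⁻ ω, ENNReal.ofReal (min (f ω) 1) ∂μ ≤ ∫⁻ u in Set.Ioc 0 1, g u := by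
  rw [lintegral_eq_lintegral_meas_lt μ (Filter.Eventually.of_forall fun ω =>
    le_min (hf0 ω) zero_le_one) (hf.min measurable_const).aemeasurable,
    ← lintegral_indicator measurableSet_Ioi, ← lintegral_indicator measurableSet_Ioc]
  refine lintegral_mono fun u => ?_
  by_cases hu0 : 0 < u
  · rw [Set.indicator_of_mem (show u ∈ Set.Ioi (0 : ℝ) from hu0)]
    by_cases hu1 : u ≤ 1
    · rw [Set.indicator_of_mem (show u ∈ Set.Ioc (0 : ℝ) 1 from ⟨hu0, hu1⟩)]
      exact (measure_mono fun ω (hω : u < min (f ω) 1) => (lt_min_iff.1 hω).1).trans (hg u hu0)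
    · have : {ω | u < min (f ω) 1} = ∅ :=
        Set.eq_empty_of_forall_notMem fun ω (hω : u < min (f ω) 1) =>
          hu1 (lt_min_iff.1 hω).2.le
      rw [this, measure_empty]
      exact zero_le
  · rw [Set.indicator_of_notMem (show u ∉ Set.Ioi (0 : ℝ) from hu0)]
    exact zero_le

/-- Truncated expectation under a tail of order `p < 1`. -/
lemma lintegral_min_one_le_div {Ω : Type*} [MeasurableSpace Ω] (μ : Measure Ω)
    {f : Ω → ℝ} (hf : Measurable f) (hf0 : ∀ ω, 0 ≤ f ω) {p K : ℝ} (hp : p < 1) (hK : 0 ≤ K)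
    (htail : ∀ u, 0 < u → μ {ω | u < f ω} ≤ ENNReal.ofReal (K * u ^ (-p))) :
    ∫⁻ ω, ENNReal.ofReal (min (f ω) 1) ∂μ ≤ ENNReal.ofReal (K / (1 - p)) := by
  refine (lintegral_min_one_le_of_tail μ hf hf0 htail).trans (le_of_eq ?_)
  have hint : IntervalIntegrable (fun u : ℝ => K * u ^ (-p)) volume 0 1 :=
    (intervalIntegral.intervalIntegrable_rpow' (by linarith)).const_mul K
  rw [← ofReal_integral_eq_lintegral_ofReal
    ((intervalIntegrable_iff_integrableOn_Ioc_of_le zero_le_one).1 hint)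
    ((ae_restrict_iff' measurableSet_Ioc).2 (Filter.Eventually.of_forall fun u hu =>
      mul_nonneg hK (Real.rpow_nonneg hu.1.le _))),
    ← intervalIntegral.integral_of_le zero_le_one, intervalIntegral.integral_const_mul,
    integral_rpow (Or.inl (by linarith)), Real.one_rpow, Real.zero_rpow (by linarith)]
  congr 1
  rw [show -p + 1 = 1 - p by ring]
  ring

/-- Truncated expectation under a tail of order `p ≤ 1`, with a logarithmic loss. -/
lemma lintegral_min_one_le_log {Ω : Type*} [MeasurableSpace Ω] (μ : Measure Ω)
    [IsProbabilityMeasure μ] {f : Ω → ℝ} (hf : Measurable f) (hf0 : ∀ ω, 0 ≤ f ω)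
    {p K u₀ : ℝ} (hp : p ≤ 1) (hK : 0 ≤ K) (hu₀ : 0 < u₀) (hu₀1 : u₀ ≤ 1)
    (htail : ∀ u, 0 < u → μ {ω | u < f ω} ≤ ENNReal.ofReal (K * u ^ (-p))) :
    ∫⁻ ω, ENNReal.ofReal (min (f ω) 1) ∂μ ≤ ENNReal.ofReal (u₀ + K * Real.log (1 / u₀)) := by
  refine (lintegral_min_one_le_of_tail μ hf hf0
    (g := fun u => μ {ω | u < f ω}) fun _ _ => le_rfl).trans ?_
  have hlog : 0 ≤ Real.log (1 / u₀) := Real.log_nonneg ((one_le_div hu₀).2 hu₀1)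
  rw [← Set.Ioc_union_Ioc_eq_Ioc hu₀.le hu₀1, ENNReal.ofReal_add hu₀.le (mul_nonneg hK hlog)]
  refine (lintegral_union_le _ _ _).trans (add_le_add ?_ ?_)
  · calc ∫⁻ u in Set.Ioc 0 u₀, μ {ω | u < f ω} ≤ ∫⁻ _ in Set.Ioc 0 u₀, 1 :=
        lintegral_mono fun u => prob_le_one
      _ = ENNReal.ofReal u₀ := by simp
  · have hint : IntervalIntegrable (fun u : ℝ => K * u⁻¹) volume u₀ 1 := by
      refine IntervalIntegrable.const_mul ?_ K
      exact intervalIntegrable_inv_iff.2 (Or.inr (by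
        rw [Set.uIcc_of_le hu₀1]; exact fun h => absurd h.1 (not_le.2 hu₀)))
    calc ∫⁻ u in Set.Ioc u₀ 1, μ {ω | u < f ω}
        ≤ ∫⁻ u in Set.Ioc u₀ 1, ENNReal.ofReal (K * u⁻¹) := by
          refine setLIntegral_mono' measurableSet_Ioc fun u hu => ?_
          have hu0 : 0 < u := hu₀.trans hu.1
          refine (htail u hu0).trans (ENNReal.ofReal_le_ofReal
            (mul_le_mul_of_nonneg_left ?_ hK))
          rw [← Real.rpow_neg_one]
          exact Real.rpow_le_rpow_of_exponent_ge hu0 hu.2 (by linarith)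
      _ = ENNReal.ofReal (K * Real.log (1 / u₀)) := by
          rw [← ofReal_integral_eq_lintegral_ofReal
            ((intervalIntegrable_iff_integrableOn_Ioc_of_le hu₀1).1 hint)
            ((ae_restrict_iff' measurableSet_Ioc).2 (Filter.Eventually.of_forall fun u hu =>
              mul_nonneg hK (inv_nonneg.2 (hu₀.trans hu.1).le))),
            ← intervalIntegral.integral_of_le hu₀1, intervalIntegral.integral_const_mul,
            integral_inv_of_pos hu₀ one_pos]

/-- The scale `144 * L` is large enough for one of the two truncated-moment bounds. -/
lemma one_le_rpow_mul_or_le_rpow {L p : ℝ} (hL : 0.69 ≤ L) (hp : 0 < p) (hp1 : p ≤ 1) :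
    (p < 1 ∧ 1 ≤ (144 * L) ^ p * (1 - p)) ∨ 4 * L ≤ (144 * L) ^ p := by
  have hL0 : 0 < L := by linarith
  rcases le_total p (1 / 2) with h | h
  · refine Or.inl ⟨by linarith, ?_⟩
    have hlog : 2 ≤ Real.log (144 * L) := by
      rw [Real.le_log_iff_exp_le (by positivity)]
      have h1 := Real.exp_one_lt_d9
      have h2 : Real.exp 2 = Real.exp 1 * Real.exp 1 := by rw [← Real.exp_add]; norm_num
      have h3 := Real.exp_pos 1
      nlinarith
    have hpow : 1 + 2 * p ≤ (144 * L) ^ p := by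
      rw [Real.rpow_def_of_pos (by positivity)]
      have := Real.add_one_le_exp (Real.log (144 * L) * p)
      nlinarith
    nlinarith
  · have h12 : (12 : ℝ) ≤ 144 ^ p := by
      calc (12 : ℝ) = 144 ^ (1 / 2 : ℝ) := by
            rw [← Real.sqrt_eq_rpow, show (144 : ℝ) = 12 ^ 2 by norm_num,
              Real.sqrt_sq (by norm_num)]
        _ ≤ 144 ^ p := Real.rpow_le_rpow_of_exponent_le (by norm_num) h
    rw [Real.mul_rpow (by norm_num) hL0.le]
    rcases le_or_gt ((1 - p) * Real.log L) 1 with hq | hq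
    · right
      have hLp : L ≤ 3 * L ^ p := by
        have : L = L ^ p * Real.exp ((1 - p) * Real.log L) := by
          rw [Real.rpow_def_of_pos hL0, ← Real.exp_add]
          conv_lhs => rw [← Real.exp_log hL0]
          congr 1; ring
        have he : Real.exp ((1 - p) * Real.log L) ≤ 3 :=
          (Real.exp_le_exp.2 hq).trans (by linarith [Real.exp_one_lt_d9])
        nlinarith [Real.rpow_pos_of_pos hL0 p]
      nlinarith [Real.rpow_pos_of_pos hL0 p]
    · left
      have hp1' : p < 1 := lt_of_le_of_ne hp1 fun h => by norm_num [h] at hq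
      refine ⟨hp1', ?_⟩
      have hlogpos : 0 < Real.log L := by
        by_contra hneg
        nlinarith
      have hL1 : 1 ≤ L := by
        by_contra hlt
        linarith [Real.log_nonpos hL0.le (not_le.1 hlt).le]
      have hlog : Real.log L ≤ 2 * L ^ p := by
        have h1 := Real.log_le_rpow_div hL0.le (show (0 : ℝ) < 1 / 2 by norm_num)
        have h2 := Real.rpow_le_rpow_of_exponent_le hL1 h
        linarith
      have hq0 : 0 < 1 - p := by linarith
      have h3 : (1 - p) * Real.log L ≤ (1 - p) * (2 * L ^ p) :=
        mul_le_mul_of_nonneg_left hlog hq0.le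
      have h4 : 12 * (L ^ p * (1 - p)) ≤ 144 ^ p * (L ^ p * (1 - p)) :=
        mul_le_mul_of_nonneg_right h12 (by positivity)
      rw [mul_assoc]
      nlinarith

/-- A weak-type tail bound at scale `R` for one summand. -/
lemma measure_lt_div_le {Ω : Type*} [MeasurableSpace Ω] (μ : Measure Ω) [IsProbabilityMeasure μ]
    {Z : Ω → ℝ} {c p : ℝ} (hc : 0 < c) (hp : 0 < p)
    (hZ : ∀ lam : ℝ, 1 < lam → μ {ω | c * lam < |Z ω|} < ENNReal.ofReal (lam ^ (-p)))
    {x R u : ℝ} (hx : 0 < x) (hR : 0 < R) (hu : 0 < u) :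
    μ {ω | u < |Z ω * x| / (c * R)} ≤ ENNReal.ofReal (x ^ p * R ^ (-p) * u ^ (-p)) := by
  have hs : 0 < u * R / x := by positivity
  have hset : {ω | u < |Z ω * x| / (c * R)} = {ω | c * (u * R / x) < |Z ω|} := by
    ext ω
    simp only [Set.mem_ofPred_eq]
    rw [abs_mul, abs_of_pos hx, lt_div_iff₀ (by positivity), ← mul_div_assoc, div_lt_iff₀ hx]
    ring_nf
  have hval : x ^ p * R ^ (-p) * u ^ (-p) = (u * R / x) ^ (-p) := by
    rw [Real.div_rpow (by positivity) hx.le, Real.mul_rpow hu.le hR.le, Real.rpow_neg hx.le,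
      div_inv_eq_mul]
    ring
  rw [hset, hval]
  rcases lt_or_ge 1 (u * R / x) with h | h
  · exact (hZ _ h).le
  · exact prob_le_one.trans (ENNReal.one_le_ofReal.2
      (Real.one_le_rpow_of_pos_of_le_one_of_nonpos hs h (by linarith)))

/-- Fix `c > 0` and `0 < p ≤ 1`. There is a constant `C > 0` (depending only on `c`) such
that: if `n ≥ 2` and `Z 1, …, Z n` are (possibly dependent) random variables with
`P(|Z i| > c λ) < λ^{-p}` for all `λ > 1`, and `X ∈ ℝ^n` has strictly positive entries
with `Y i = Z i * X i`, then for all `λ ≥ 1`,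
`P(∑ i |Y i| ≥ C λ^{1/p} log(n λ) ‖X‖_p) ≤ 1/λ`. -/
theorem stmt_7 (c : ℝ) (hc : 0 < c) :
    ∃ C : ℝ, 0 < C ∧
      ∀ p : ℝ, 0 < p → p ≤ 1 →
        ∀ (n : ℕ), 2 ≤ n →
          ∀ (Ω : Type) [MeasurableSpace Ω] (μ : Measure Ω), IsProbabilityMeasure μ →
            ∀ Z : Fin n → Ω → ℝ, (∀ i, Measurable (Z i)) →
              (∀ i, ∀ lam : ℝ, 1 < lam →
                μ {ω | c * lam < |Z i ω|} < ENNReal.ofReal (lam ^ (-p))) →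
              ∀ X : Fin n → ℝ, (∀ i, 0 < X i) →
                ∀ lam : ℝ, 1 ≤ lam →
                  μ {ω | C * lam ^ (1 / p) * Real.log (n * lam)
                        * (∑ i, |X i| ^ p) ^ (1 / p)
                      ≤ ∑ i, |Z i ω * X i|}
                    ≤ ENNReal.ofReal (1 / lam) := by
  refine ⟨c * 144, by positivity, ?_⟩
  intro p hp hp1 n hn Ω _ μ hμ Z hZm hZ X hX lam hlam
  have hn' : (2 : ℝ) ≤ n := by exact_mod_cast hn
  have hlam0 : 0 < lam := by linarith
  have hnl : 2 ≤ (n : ℝ) * lam := by nlinarith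
  set L := Real.log (n * lam) with hLdef
  have hL : 0.69 ≤ L := by
    have := Real.log_le_log (by norm_num) hnl
    linarith [Real.log_two_gt_d9]
  have hL0 : 0 < L := by linarith
  have hSX : ∑ i, |X i| ^ p = ∑ i, X i ^ p :=
    Finset.sum_congr rfl fun i _ => by rw [abs_of_pos (hX i)]
  rw [hSX]
  set S := ∑ i, X i ^ p with hSdef
  have hS : 0 < S :=
    Finset.sum_pos (fun i _ => Real.rpow_pos_of_pos (hX i) p) ⟨⟨0, by omega⟩, Finset.mem_univ _⟩
  set R := lam ^ (1 / p) * (144 * L) * S ^ (1 / p) with hRdef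
  have hR : 0 < R := by positivity
  have hRp : R ^ p = lam * (144 * L) ^ p * S := by
    rw [hRdef, Real.mul_rpow (by positivity) (by positivity),
      Real.mul_rpow (by positivity) (by positivity), ← Real.rpow_mul hlam0.le,
      ← Real.rpow_mul hS.le, one_div_mul_cancel hp.ne', Real.rpow_one, Real.rpow_one]
  set T := (144 * L) ^ p with hTdef
  have hT : 0 < T := by positivity
  set f : Fin n → Ω → ℝ := fun i ω => |Z i ω * X i| / (c * R) with hfdef
  have hfm : ∀ i, Measurable (f i) := fun i =>
    (((hZm i).mul_const (X i)).abs).div_const _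
  have hf0 : ∀ i ω, 0 ≤ f i ω := fun i ω => by positivity
  have htail : ∀ i u, 0 < u →
      μ {ω | u < f i ω} ≤ ENNReal.ofReal (X i ^ p * R ^ (-p) * u ^ (-p)) := fun i u hu =>
    measure_lt_div_le μ hc hp (hZ i) (hX i) hR hu
  have hK : ∀ i, 0 ≤ X i ^ p * R ^ (-p) := fun i =>
    mul_nonneg (Real.rpow_nonneg (hX i).le _) (Real.rpow_nonneg hR.le _)
  have hsumK : ∑ i, X i ^ p * R ^ (-p) = 1 / (lam * T) := by
    rw [← Finset.sum_mul, ← hSdef, Real.rpow_neg hR.le, hRp]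
    field_simp
  have hset : {ω | c * 144 * lam ^ (1 / p) * L * S ^ (1 / p) ≤ ∑ i, |Z i ω * X i|}
      = {ω | 1 ≤ ∑ i, f i ω} := by
    ext ω
    simp only [Set.mem_ofPred_eq, hfdef]
    rw [← Finset.sum_div, one_le_div (by positivity), hRdef]
    ring_nf
  rw [hset]
  refine (measure_one_le_sum_le μ f hfm hf0).trans ?_
  rcases one_le_rpow_mul_or_le_rpow hL hp hp1 with ⟨hp1', h⟩ | h
  · have hq : 0 < 1 - p := by linarith
    refine (Finset.sum_le_sum fun i _ =>
      lintegral_min_one_le_div μ (hfm i) (hf0 i) hp1' (hK i) (htail i)).trans ?_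
    rw [← ENNReal.ofReal_sum_of_nonneg fun i _ => div_nonneg (hK i) hq.le, ← Finset.sum_div,
      hsumK, div_div]
    refine ENNReal.ofReal_le_ofReal (one_div_le_one_div_of_le hlam0 ?_)
    nlinarith
  · have hu₀ : 0 < 1 / ((n : ℝ) * lam) ^ 2 := by positivity
    have hu₀1 : 1 / ((n : ℝ) * lam) ^ 2 ≤ 1 := by
      rw [div_le_one (by positivity)]
      nlinarith
    have hlog : Real.log (1 / (1 / ((n : ℝ) * lam) ^ 2)) = 2 * L := by
      rw [one_div_one_div, Real.log_pow, ← hLdef]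
      norm_num
    refine (Finset.sum_le_sum fun i _ =>
      lintegral_min_one_le_log μ (hfm i) (hf0 i) hp1 (hK i) hu₀ hu₀1 (htail i)).trans ?_
    rw [hlog, ← ENNReal.ofReal_sum_of_nonneg fun i _ =>
      add_nonneg hu₀.le (mul_nonneg (hK i) (by positivity)), Finset.sum_add_distrib,
      ← Finset.sum_mul, hsumK, Finset.sum_const, Finset.card_univ, Fintype.card_fin,
      nsmul_eq_mul]
    refine ENNReal.ofReal_le_ofReal ?_
    have h1 : (n : ℝ) * (1 / (n * lam) ^ 2) ≤ 1 / (2 * lam) := by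
      rw [mul_one_div, div_le_div_iff₀ (by positivity) (by positivity)]
      have : 0 ≤ (n : ℝ) * lam * (n * lam - 2) := by
        have : 0 ≤ (n : ℝ) * lam - 2 := by linarith
        positivity
      nlinarith
    have h2 : 1 / (lam * T) * (2 * L) ≤ 1 / (2 * lam) := by
      rw [one_div_mul_eq_div, div_le_div_iff₀ (by positivity) (by positivity)]
      nlinarith
    have h3 : 1 / lam = 1 / (2 * lam) + 1 / (2 * lam) := by field_simp; norm_num
    linarith
end

section
/- There is a universal constant C > 0 such that the following holds. For all ε, δ ∈ (0,1), all positive integers n, t₁, t₂, all matrices X ∈ ℝ^{n×t₁} and Y ∈ ℝ^{n×t₂}, and all integers k ≥ C/(δε²): if S ∈ ℝ^{k×n} is a random matrix whose entries are i.i.d. Gaussian with mean 0 and variance 1/k, then with probability at least 1 − δ (over S) all three of the following hold: ‖XᵀSᵀSY − XᵀY‖_F ≤ ε‖X‖_F‖Y‖_F, (1−ε)‖X‖_F ≤ ‖SX‖_F ≤ (1+ε)‖X‖_F, and (1−ε)‖Y‖_F ≤ ‖SY‖_F ≤ (1+ε)‖Y‖_F. -/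
open MeasureTheory ProbabilityTheory
open scoped NNReal

lemma iteratedDeriv_exp_sq_zero (w : ℝ) :
    iteratedDeriv 2 (fun s : ℝ ↦ Real.exp (w * s ^ 2 / 2)) 0 = w ∧
      iteratedDeriv 4 (fun s : ℝ ↦ Real.exp (w * s ^ 2 / 2)) 0 = 3 * w ^ 2 := by
  have key (p p' : ℝ → ℝ) (hp : ∀ s, HasDerivAt p (p' s) s) :
      deriv (fun s ↦ p s * Real.exp (w * s ^ 2 / 2)) =
        fun s ↦ (p' s + p s * (w * s)) * Real.exp (w * s ^ 2 / 2) := by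
    ext s
    have h : HasDerivAt (fun s : ℝ ↦ w * s ^ 2 / 2) (w * s) s := by
      convert! (((hasDerivAt_id s).pow 2).const_mul w).div_const 2 using 1
      simp; ring
    refine ((hp s).mul h.exp).deriv.trans ?_
    ring
  have h1 : deriv (fun s : ℝ ↦ Real.exp (w * s ^ 2 / 2)) =
      fun s ↦ (w * s) * Real.exp (w * s ^ 2 / 2) := by
    simpa using key (fun _ ↦ 1) (fun _ ↦ 0) fun s ↦ hasDerivAt_const s 1
  have h2 := key (fun s ↦ w * s) (fun _ ↦ w) fun s ↦ by
    simpa using (hasDerivAt_id s).const_mul w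
  have h3 := key (fun s ↦ w + w * s * (w * s)) (fun s ↦ 2 * w ^ 2 * s) fun s ↦ by
    have := (hasDerivAt_id s).const_mul w
    convert! (this.mul this).const_add w using 1
    simp; ring
  have h4 := key (fun s ↦ 2 * w ^ 2 * s + (w + w * s * (w * s)) * (w * s))
      (fun s ↦ 3 * w ^ 2 + 3 * w ^ 3 * s ^ 2) fun s ↦ by
    have := (hasDerivAt_id s).const_mul w
    convert! ((hasDerivAt_id s).const_mul (2 * w ^ 2)).add
      (((this.mul this).const_add w).mul this) using 1
    simp; ring
  simp only [iteratedDeriv_eq_iterate, Function.iterate_succ, Function.iterate_zero,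
    Function.comp_apply, id_eq, h1, h2, h3, h4]
  simp

lemma integral_pow_of_mgf_eq {Ω : Type*} {mΩ : MeasurableSpace Ω} {P : Measure Ω}
    [IsProbabilityMeasure P] {X : Ω → ℝ} {w : ℝ}
    (h : ∀ s, mgf X P s = Real.exp (w * s ^ 2 / 2)) :
    (∀ n : ℕ, Integrable (fun ω ↦ X ω ^ n) P) ∧
      ∫ ω, X ω ^ 2 ∂P = w ∧ ∫ ω, X ω ^ 4 ∂P = 3 * w ^ 2 := by
  have hset : integrableExpSet X P = Set.univ := by
    ext s
    simp only [integrableExpSet, Set.mem_ofPred_eq, Set.mem_univ, iff_true]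
    rw [← mgf_pos_iff, h s]
    exact Real.exp_pos _
  have h0 : (0 : ℝ) ∈ interior (integrableExpSet X P) := by simp [hset]
  have hX : mgf X P = fun s ↦ Real.exp (w * s ^ 2 / 2) := funext h
  have e (n : ℕ) := iteratedDeriv_mgf_zero h0 n
  simp only [hX] at e
  exact ⟨integrable_pow_of_mem_interior_integrableExpSet h0,
    by simpa using (e 2).symm.trans (iteratedDeriv_exp_sq_zero w).1,
    by simpa using (e 4).symm.trans (iteratedDeriv_exp_sq_zero w).2⟩

section Gaussian

variable {ι : Type*} [Fintype ι]

lemma mgf_linearForm_pi_gaussianReal (v : ℝ≥0) (t : ι → ℝ) (s : ℝ) :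
    mgf (fun g : ι → ℝ ↦ ∑ i, t i * g i) (Measure.pi fun _ ↦ gaussianReal 0 v) s =
      Real.exp ((v * ∑ i, t i ^ 2) * s ^ 2 / 2) := by
  simp only [mgf, Finset.mul_sum, Real.exp_sum]
  rw [integral_fintype_prod_eq_prod (fun i x ↦ Real.exp (s * (t i * x)))]
  have (i : ι) : ∫ x, Real.exp (s * (t i * x)) ∂gaussianReal 0 v =
      Real.exp (v * t i ^ 2 * s ^ 2 / 2) := by
    have := congrFun (mgf_fun_id_gaussianReal (μ := 0) (v := v)) (s * t i)
    simp only [mgf] at this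
    simp only [← mul_assoc, this]
    ring_nf
  simp only [this, ← Real.exp_sum, Finset.sum_mul, Finset.sum_div]

lemma memLp_eval_pi_gaussianReal (v : ℝ≥0) (a : ι) {p : ENNReal} (hp : p ≠ ⊤) :
    MemLp (fun g : ι → ℝ ↦ g a) p (Measure.pi fun _ ↦ gaussianReal 0 v) :=
  (memLp_id_gaussianReal' p hp).comp_measurePreserving
    (measurePreserving_eval (fun _ : ι ↦ gaussianReal 0 v) a)

lemma memLp_mul_pi_gaussianReal (v : ℝ≥0) (a b : ι) :
    MemLp (fun g : ι → ℝ ↦ g a * g b) 2 (Measure.pi fun _ ↦ gaussianReal 0 v) := by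
  have : ENNReal.HolderTriple 4 4 2 := by
    constructor
    rw [← ENNReal.toReal_eq_toReal_iff' (by simp) (by simp), ENNReal.toReal_add (by simp) (by simp)]
    norm_num [ENNReal.toReal_inv]
  exact (memLp_eval_pi_gaussianReal v b (p := 4) (by simp)).mul'
    (memLp_eval_pi_gaussianReal v a (p := 4) (by simp))

lemma integrable_sq_quadForm_sub_trace (v : ℝ≥0) (A : ι → ι → ℝ) :
    Integrable (fun g : ι → ℝ ↦ (∑ a, ∑ b, A a b * (g a * g b) - v * ∑ a, A a a) ^ 2)
      (Measure.pi fun _ ↦ gaussianReal 0 v) :=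
  ((memLp_finsetSum _ fun a _ ↦ memLp_finsetSum _ fun b _ ↦
    (memLp_mul_pi_gaussianReal v a b).const_mul (A a b)).sub (memLp_const _)).integrable_sq

variable [DecidableEq ι]

lemma moments_linearForm_four_pi_gaussianReal (v : ℝ≥0) (a b c d : ι) (x y z : ℝ) :
    (∀ n : ℕ, Integrable (fun g : ι → ℝ ↦ (g a + x * g b + y * g c + z * g d) ^ n)
      (Measure.pi fun _ ↦ gaussianReal 0 v)) ∧
    ∫ g : ι → ℝ, (g a + x * g b + y * g c + z * g d) ^ 2
        ∂(Measure.pi fun _ ↦ gaussianReal 0 v) =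
      v * (1 + x ^ 2 + y ^ 2 + z ^ 2 + 2 * (x * (if a = b then 1 else 0)
        + y * (if a = c then 1 else 0) + z * (if a = d then 1 else 0)
        + x * y * (if b = c then 1 else 0) + x * z * (if b = d then 1 else 0)
        + y * z * (if c = d then 1 else 0))) ∧
    ∫ g : ι → ℝ, (g a + x * g b + y * g c + z * g d) ^ 4
        ∂(Measure.pi fun _ ↦ gaussianReal 0 v) =
      3 * (v * (1 + x ^ 2 + y ^ 2 + z ^ 2 + 2 * (x * (if a = b then 1 else 0)
        + y * (if a = c then 1 else 0) + z * (if a = d then 1 else 0)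
        + x * y * (if b = c then 1 else 0) + x * z * (if b = d then 1 else 0)
        + y * z * (if c = d then 1 else 0)))) ^ 2 := by
  set e : ι → ι → ℝ := fun a i ↦ if a = i then 1 else 0 with he
  have h := integral_pow_of_mgf_eq
    (mgf_linearForm_pi_gaussianReal v fun i ↦ e a i + x * e b i + y * e c i + z * e d i)
  have hlin (g : ι → ℝ) : ∑ i, (e a i + x * e b i + y * e c i + z * e d i) * g i =
      g a + x * g b + y * g c + z * g d := by
    simp [he, add_mul, Finset.sum_add_distrib]
  have hdot (p q : ι) : ∑ i, e p i * e q i = if p = q then 1 else 0 := by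
    simp [he]
  have hsq : ∑ i, (e a i + x * e b i + y * e c i + z * e d i) ^ 2 =
      1 + x ^ 2 + y ^ 2 + z ^ 2 + 2 * (x * (if a = b then 1 else 0)
        + y * (if a = c then 1 else 0) + z * (if a = d then 1 else 0)
        + x * y * (if b = c then 1 else 0) + x * z * (if b = d then 1 else 0)
        + y * z * (if c = d then 1 else 0)) := by
    have : ∑ i, (e a i + x * e b i + y * e c i + z * e d i) ^ 2 =
        ∑ i, e a i * e a i + x ^ 2 * ∑ i, e b i * e b i + y ^ 2 * ∑ i, e c i * e c i
          + z ^ 2 * ∑ i, e d i * e d i + 2 * (x * ∑ i, e a i * e b i + y * ∑ i, e a i * e c i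
          + z * ∑ i, e a i * e d i + x * y * ∑ i, e b i * e c i + x * z * ∑ i, e b i * e d i
          + y * z * ∑ i, e c i * e d i) := by
      simp only [Finset.mul_sum, ← Finset.sum_add_distrib]
      exact Finset.sum_congr rfl fun i _ ↦ by ring
    rw [this]
    simp only [hdot]
    simp
  simpa only [hlin, hsq] using h

lemma integral_mul_pi_gaussianReal (v : ℝ≥0) (a b : ι) :
    ∫ g : ι → ℝ, g a * g b ∂(Measure.pi fun _ ↦ gaussianReal 0 v) =
      v * if a = b then 1 else 0 := by
  have h (x : ℝ) := moments_linearForm_four_pi_gaussianReal v a b b b x 0 0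
  have hpol (g : ι → ℝ) : g a * g b = 1 / 4 * ((g a + 1 * g b + 0 * g b + 0 * g b) ^ 2
      - (g a + (-1) * g b + 0 * g b + 0 * g b) ^ 2) := by ring
  simp only [hpol]
  rw [integral_const_mul, integral_sub ((h 1).1 2) ((h (-1)).1 2), (h 1).2.1, (h (-1)).2.1]
  ring

/-- Isserlis' formula for products of four coordinates. -/
lemma integral_mul_four_pi_gaussianReal (v : ℝ≥0) (a b c d : ι) :
    ∫ g : ι → ℝ, (g a * g b) * (g c * g d) ∂(Measure.pi fun _ ↦ gaussianReal 0 v) =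
      v ^ 2 * ((if a = b then 1 else 0) * (if c = d then 1 else 0)
        + (if a = c then 1 else 0) * (if b = d then 1 else 0)
        + (if a = d then 1 else 0) * (if b = c then 1 else 0)) := by
  have h (x y z : ℝ) := moments_linearForm_four_pi_gaussianReal v a b c d x y z
  set F : ℝ → ℝ → ℝ → (ι → ℝ) → ℝ := fun x y z g ↦ (g a + x * g b + y * g c + z * g d) ^ 4
  have hF (x y z : ℝ) : Integrable (F x y z) (Measure.pi fun _ ↦ gaussianReal 0 v) := (h x y z).1 4
  have hpol (g : ι → ℝ) : (g a * g b) * (g c * g d) =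
      1 / 192 * (F 1 1 1 g - F 1 1 (-1) g - F 1 (-1) 1 g - F (-1) 1 1 g
        + F 1 (-1) (-1) g + F (-1) 1 (-1) g + F (-1) (-1) 1 g - F (-1) (-1) (-1) g) := by
    simp only [F]
    ring
  simp only [hpol]
  rw [integral_const_mul, integral_sub (by fun_prop) (by fun_prop),
    integral_add (by fun_prop) (by fun_prop), integral_add (by fun_prop) (by fun_prop),
    integral_add (by fun_prop) (by fun_prop), integral_sub (by fun_prop) (by fun_prop),
    integral_sub (by fun_prop) (by fun_prop), integral_sub (by fun_prop) (by fun_prop)]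
  simp only [F, (h _ _ _).2.2]
  ring

lemma integral_sq_quadForm_sub_trace_le (v : ℝ≥0) (A : ι → ι → ℝ) :
    ∫ g : ι → ℝ, (∑ a, ∑ b, A a b * (g a * g b) - v * ∑ a, A a a) ^ 2
        ∂(Measure.pi fun _ ↦ gaussianReal 0 v) ≤
      2 * v ^ 2 * ∑ a, ∑ b, A a b ^ 2 := by
  set P := Measure.pi fun _ : ι ↦ gaussianReal 0 v
  set D : ι → ι → ℝ := fun a b ↦ if a = b then 1 else 0 with hD
  set H : ι → ι → (ι → ℝ) → ℝ := fun a b g ↦ g a * g b - v * D a b with hH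
  have hHL (a b : ι) : MemLp (H a b) 2 P :=
    (memLp_mul_pi_gaussianReal v a b).sub (memLp_const _)
  have hHi (a b c d : ι) : Integrable (fun g ↦ H a b g * H c d g) P :=
    (hHL a b).integrable_mul (hHL c d)
  have hcov (a b c d : ι) : ∫ g, H a b g * H c d g ∂P =
      v ^ 2 * (D a c * D b d + D a d * D b c) := by
    have i1 (a b : ι) : Integrable (fun g : ι → ℝ ↦ g a * g b) P :=
      (memLp_mul_pi_gaussianReal v a b).integrable (by norm_num)
    have i2 : Integrable (fun g : ι → ℝ ↦ (g a * g b) * (g c * g d)) P :=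
      (memLp_mul_pi_gaussianReal v a b).integrable_mul (memLp_mul_pi_gaussianReal v c d)
    have e (g : ι → ℝ) : H a b g * H c d g = (g a * g b) * (g c * g d)
        - v * D c d * (g a * g b) - v * D a b * (g c * g d) + v ^ 2 * D a b * D c d := by
      simp only [hH]; ring
    simp only [e]
    rw [integral_add (by fun_prop) (by fun_prop), integral_sub (by fun_prop) (by fun_prop),
      integral_sub (by fun_prop) (by fun_prop), integral_const_mul, integral_const_mul,
      integral_mul_pi_gaussianReal, integral_mul_pi_gaussianReal,
      integral_mul_four_pi_gaussianReal]
    simp only [hD, integral_const, probReal_univ, smul_eq_mul]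
    ring
  have hexp (g : ι → ℝ) : (∑ a, ∑ b, A a b * (g a * g b) - v * ∑ a, A a a) ^ 2 =
      ∑ a, ∑ b, ∑ c, ∑ d, A a b * A c d * (H a b g * H c d g) := by
    have : ∑ a, ∑ b, A a b * (g a * g b) - v * ∑ a, A a a = ∑ a, ∑ b, A a b * H a b g := by
      simp [hH, hD, mul_sub, Finset.sum_sub_distrib, Finset.mul_sum, mul_comm]
    rw [this, sq, Finset.sum_mul]
    refine Finset.sum_congr rfl fun a _ ↦ ?_
    rw [Finset.sum_mul]
    refine Finset.sum_congr rfl fun b _ ↦ ?_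
    simp only [Finset.mul_sum]
    exact Finset.sum_congr rfl fun c _ ↦ Finset.sum_congr rfl fun d _ ↦ by ring
  simp only [hexp]
  have hint : ∫ g, ∑ a, ∑ b, ∑ c, ∑ d, A a b * A c d * (H a b g * H c d g) ∂P =
      ∑ a, ∑ b, ∑ c, ∑ d, A a b * A c d * (v ^ 2 * (D a c * D b d + D a d * D b c)) := by
    rw [integral_finsetSum _ fun _ _ ↦ by fun_prop]
    refine Finset.sum_congr rfl fun a _ ↦ ?_
    rw [integral_finsetSum _ fun _ _ ↦ by fun_prop]
    refine Finset.sum_congr rfl fun b _ ↦ ?_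
    rw [integral_finsetSum _ fun _ _ ↦ by fun_prop]
    refine Finset.sum_congr rfl fun c _ ↦ ?_
    rw [integral_finsetSum _ fun _ _ ↦ by fun_prop]
    refine Finset.sum_congr rfl fun d _ ↦ ?_
    rw [integral_const_mul, hcov]
  have hcol (a b : ι) : ∑ c, ∑ d, A a b * A c d * (v ^ 2 * (D a c * D b d + D a d * D b c)) =
      v ^ 2 * (A a b ^ 2 + A a b * A b a) := by
    simp [hD, mul_add, Finset.sum_add_distrib]
    ring
  rw [hint]
  simp only [hcol]
  have hswap : ∑ a, ∑ b, A b a ^ 2 = ∑ a, ∑ b, A a b ^ 2 := Finset.sum_comm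
  calc ∑ a, ∑ b, (v : ℝ) ^ 2 * (A a b ^ 2 + A a b * A b a)
      ≤ ∑ a, ∑ b, (v : ℝ) ^ 2 * (A a b ^ 2 + (A a b ^ 2 + A b a ^ 2) / 2) := by
        gcongr with a _ b _
        nlinarith [sq_nonneg (A a b - A b a)]
    _ = 2 * v ^ 2 * ∑ a, ∑ b, A a b ^ 2 := by
        simp only [← Finset.mul_sum, Finset.sum_add_distrib, ← Finset.sum_div, hswap]
        ring

end Gaussian

section Sketch

variable {k n : ℕ}

lemma sketch_quadForm_variance (hk : 0 < k) (B : Fin n → Fin n → ℝ) :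
    Integrable (fun S : Fin k × Fin n → ℝ ↦
        (∑ i, ∑ j, ∑ l, B j l * (S (i, j) * S (i, l)) - ∑ j, B j j) ^ 2)
      (Measure.pi fun _ ↦ gaussianReal 0 (k : ℝ≥0)⁻¹) ∧
    ∫ S : Fin k × Fin n → ℝ,
        (∑ i, ∑ j, ∑ l, B j l * (S (i, j) * S (i, l)) - ∑ j, B j j) ^ 2
        ∂(Measure.pi fun _ ↦ gaussianReal 0 (k : ℝ≥0)⁻¹) ≤
      2 / k * ∑ j, ∑ l, B j l ^ 2 := by
  have hk' : (k : ℝ) ≠ 0 := by positivity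
  set A : Fin k × Fin n → Fin k × Fin n → ℝ :=
    fun p q ↦ if p.1 = q.1 then B p.2 q.2 else 0 with hA
  have hquad (S : Fin k × Fin n → ℝ) : ∑ p, ∑ q, A p q * (S p * S q) =
      ∑ i, ∑ j, ∑ l, B j l * (S (i, j) * S (i, l)) := by
    simp only [hA, Fintype.sum_prod_type]
    refine Finset.sum_congr rfl fun i _ ↦ Finset.sum_congr rfl fun j _ ↦ ?_
    rw [Finset.sum_comm]
    simp
  have htr : ((k : ℝ≥0)⁻¹ : ℝ≥0) * ∑ p, A p p = ∑ j, B j j := by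
    simp [hA, Fintype.sum_prod_type, hk']
  have hsq : ∑ p, ∑ q, A p q ^ 2 = k * ∑ j, ∑ l, B j l ^ 2 := by
    have (i : Fin k) (j : Fin n) : ∑ i', ∑ l, A (i, j) (i', l) ^ 2 = ∑ l, B j l ^ 2 := by
      rw [Finset.sum_comm]
      simp [hA, ite_pow]
    simp [Fintype.sum_prod_type, this]
  have h1 := integrable_sq_quadForm_sub_trace (k : ℝ≥0)⁻¹ A
  have h2 := integral_sq_quadForm_sub_trace_le (k : ℝ≥0)⁻¹ A
  rw [htr, hsq] at h2
  rw [htr] at h1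
  simp only [hquad] at h1 h2
  refine ⟨h1, h2.trans_eq ?_⟩
  push_cast
  field_simp

lemma measure_lt_le_of_integral_le {Ω : Type*} {mΩ : MeasurableSpace Ω} {P : Measure Ω}
    [IsProbabilityMeasure P] {F : Ω → ℝ} (hF : ∀ ω, 0 ≤ F ω) (hFi : Integrable F P)
    {η τ : ℝ} (hτ : 0 ≤ τ) (h : ∫ ω, F ω ∂P ≤ η * τ) :
    P {ω | τ < F ω} ≤ ENNReal.ofReal η := by
  rcases hτ.eq_or_lt with rfl | hτ
  · have h0 : ∫ ω, F ω ∂P = 0 := le_antisymm (by simpa using h) (integral_nonneg hF)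
    have hae : F =ᵐ[P] 0 := (integral_eq_zero_iff_of_nonneg hF hFi).1 h0
    have : P {ω | 0 < F ω} = 0 := by
      refine measure_mono_null (fun ω hω ↦ ?_) hae
      exact ne_of_gt hω
    simp [this]
  · have hm := mul_meas_ge_le_integral_of_nonneg (.of_forall hF) hFi τ
    have : P.real {ω | τ ≤ F ω} ≤ η := by
      refine le_of_mul_le_mul_left (hm.trans (h.trans_eq (mul_comm _ _))) hτ
    calc P {ω | τ < F ω} ≤ P {ω | τ ≤ F ω} := measure_mono fun ω (hω : τ < F ω) ↦ hω.le
      _ = ENNReal.ofReal (P.real {ω | τ ≤ F ω}) := by simp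
      _ ≤ ENNReal.ofReal η := ENNReal.ofReal_le_ofReal this

lemma measure_sketch_mul_error_le {t₁ t₂ : ℕ} (hk : 0 < k)
    (X : Fin n → Fin t₁ → ℝ) (Y : Fin n → Fin t₂ → ℝ) {ε : ℝ} (hε : 0 < ε) :
    (Measure.pi fun _ : Fin k × Fin n => gaussianReal 0 (k : ℝ≥0)⁻¹)
      {S | ε ^ 2 * ((∑ j, ∑ c, X j c ^ 2) * ∑ j, ∑ c, Y j c ^ 2) <
        ∑ c₁, ∑ c₂, ((∑ i, (∑ j, S (i, j) * X j c₁) * (∑ j, S (i, j) * Y j c₂))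
          - ∑ j, X j c₁ * Y j c₂) ^ 2} ≤ ENNReal.ofReal (2 / (k * ε ^ 2)) := by
  have hrw (S : Fin k × Fin n → ℝ) (c₁ : Fin t₁) (c₂ : Fin t₂) :
      ∑ i, (∑ j, S (i, j) * X j c₁) * (∑ j, S (i, j) * Y j c₂) =
        ∑ i, ∑ j, ∑ l, (X j c₁ * Y l c₂) * (S (i, j) * S (i, l)) := by
    simp only [Finset.sum_mul_sum]
    exact Finset.sum_congr rfl fun i _ ↦ Finset.sum_congr rfl fun j _ ↦
      Finset.sum_congr rfl fun l _ ↦ by ring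
  simp only [hrw]
  have h (c₁ : Fin t₁) (c₂ : Fin t₂) :=
    sketch_quadForm_variance hk fun j l ↦ X j c₁ * Y l c₂
  refine measure_lt_le_of_integral_le (fun S ↦ by positivity)
    (integrable_finsetSum _ fun c₁ _ ↦ integrable_finsetSum _ fun c₂ _ ↦ (h c₁ c₂).1)
    (by positivity) ?_
  rw [integral_finsetSum _ fun c₁ _ ↦ integrable_finsetSum _ fun c₂ _ ↦ (h c₁ c₂).1]
  simp_rw [integral_finsetSum _ fun c₂ _ ↦ (h _ c₂).1]
  calc _ ≤ ∑ c₁, ∑ c₂, 2 / (k : ℝ) * ∑ j, ∑ l, (X j c₁ * Y l c₂) ^ 2 := by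
        gcongr with c₁ _ c₂ _
        exact (h c₁ c₂).2
    _ = 2 / k * ((∑ c, ∑ j, X j c ^ 2) * ∑ c, ∑ j, Y j c ^ 2) := by
        rw [Finset.sum_mul_sum]
        simp only [mul_pow, ← Finset.mul_sum (Finset.univ : Finset (Fin t₂)),
          ← Finset.mul_sum (Finset.univ : Finset (Fin t₁)), Finset.sum_mul_sum]
    _ = _ := by
        rw [Finset.sum_comm, Finset.sum_comm (f := fun c j ↦ Y j c ^ 2)]
        field_simp

lemma sum_sq_gram_le {t : ℕ} (X : Fin n → Fin t → ℝ) :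
    ∑ j, ∑ l, (∑ c, X j c * X l c) ^ 2 ≤ (∑ j, ∑ c, X j c ^ 2) ^ 2 := by
  rw [sq (∑ j, _), Finset.sum_mul_sum]
  gcongr with j _ l _
  exact Finset.sum_mul_sq_le_sq_mul_sq _ _ _

lemma measure_sketch_norm_error_le {t : ℕ} (hk : 0 < k) (X : Fin n → Fin t → ℝ)
    {ε : ℝ} (hε : 0 < ε) :
    (Measure.pi fun _ : Fin k × Fin n => gaussianReal 0 (k : ℝ≥0)⁻¹)
      {S | ε ^ 2 * (∑ j, ∑ c, X j c ^ 2) ^ 2 <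
        (∑ i, ∑ c, (∑ j, S (i, j) * X j c) ^ 2 - ∑ j, ∑ c, X j c ^ 2) ^ 2} ≤
      ENNReal.ofReal (2 / (k * ε ^ 2)) := by
  have h := sketch_quadForm_variance hk fun j l ↦ ∑ c, X j c * X l c
  have hrw (S : Fin k × Fin n → ℝ) (i : Fin k) : ∑ c, (∑ j, S (i, j) * X j c) ^ 2 =
      ∑ j, ∑ l, (∑ c, X j c * X l c) * (S (i, j) * S (i, l)) := by
    simp only [sq, Finset.sum_mul_sum]
    simp only [Finset.sum_mul]
    rw [Finset.sum_comm]
    refine Finset.sum_congr rfl fun j _ ↦ ?_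
    rw [Finset.sum_comm]
    exact Finset.sum_congr rfl fun l _ ↦ Finset.sum_congr rfl fun c _ ↦ by ring
  have htr : ∑ j, ∑ c, X j c ^ 2 = ∑ j, ∑ c, X j c * X j c := by simp only [sq]
  rw [← htr] at h
  simp only [hrw]
  refine measure_lt_le_of_integral_le (fun S ↦ by positivity) h.1 (by positivity) ?_
  calc _ ≤ 2 / (k : ℝ) * (∑ j, ∑ c, X j c ^ 2) ^ 2 := by
        refine h.2.trans ?_
        gcongr
        exact sum_sq_gram_le X
    _ = _ := by field_simp

end Sketch

lemma sqrt_bounds_of_sq_sub_le {ε N M : ℝ} (hε : 0 < ε) (hε1 : ε < 1) (hN : 0 ≤ N)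
    (h : (M - N) ^ 2 ≤ ε ^ 2 * N ^ 2) :
    (1 - ε) * √N ≤ √M ∧ √M ≤ (1 + ε) * √N := by
  have h' := abs_le_of_sq_le_sq' (by rwa [mul_pow] : (M - N) ^ 2 ≤ (ε * N) ^ 2) (by positivity)
  have hs := Real.sq_sqrt hN
  constructor
  · apply Real.le_sqrt_of_sq_le
    rw [mul_pow, hs]
    nlinarith [mul_nonneg hε.le hN, mul_nonneg (mul_nonneg hε.le (sub_nonneg.2 hε1.le)) hN]
  · apply Real.sqrt_le_iff.2 ⟨by positivity, ?_⟩
    rw [mul_pow, hs]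
    nlinarith [mul_nonneg hε.le hN, mul_nonneg (sq_nonneg ε) hN]

lemma ofReal_one_sub_le_measure_compl_union {Ω : Type*} {mΩ : MeasurableSpace Ω} {P : Measure Ω}
    [IsProbabilityMeasure P] {E₁ E₂ E₃ : Set Ω} {δ : ℝ} (hδ : 0 ≤ δ)
    (h₁ : P E₁ ≤ ENNReal.ofReal (δ / 3)) (h₂ : P E₂ ≤ ENNReal.ofReal (δ / 3))
    (h₃ : P E₃ ≤ ENNReal.ofReal (δ / 3)) :
    ENNReal.ofReal (1 - δ) ≤ P (E₁ ∪ E₂ ∪ E₃)ᶜ := by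
  have hbad : P (E₁ ∪ E₂ ∪ E₃) ≤ ENNReal.ofReal δ := by
    calc P (E₁ ∪ E₂ ∪ E₃) ≤ P E₁ + P E₂ + P E₃ :=
          (measure_union_le _ _).trans (by gcongr; exact measure_union_le _ _)
      _ ≤ ENNReal.ofReal (δ / 3) + ENNReal.ofReal (δ / 3) + ENNReal.ofReal (δ / 3) := by gcongr
      _ = ENNReal.ofReal δ := by
          rw [← ENNReal.ofReal_add (by positivity) (by positivity),
            ← ENNReal.ofReal_add (by positivity) (by positivity)]
          ring_nf
  rw [ENNReal.ofReal_sub _ hδ, ENNReal.ofReal_one, tsub_le_iff_right, ← measure_univ (μ := P),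
    ← Set.compl_union_self (E₁ ∪ E₂ ∪ E₃)]
  exact (measure_union_le _ _).trans (by gcongr)

/-- There is a universal constant `C > 0` such that for all `ε, δ ∈ (0,1)`, all matrices
`X ∈ ℝ^{n×t₁}`, `Y ∈ ℝ^{n×t₂}`, and all integers `k ≥ C/(δ ε²)`: if `S ∈ ℝ^{k×n}` has
i.i.d. `N(0, 1/k)` entries, then with probability at least `1 - δ`,
`‖XᵀSᵀSY - XᵀY‖_F ≤ ε ‖X‖_F ‖Y‖_F`, `(1-ε)‖X‖_F ≤ ‖SX‖_F ≤ (1+ε)‖X‖_F`, and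
`(1-ε)‖Y‖_F ≤ ‖SY‖_F ≤ (1+ε)‖Y‖_F`. -/
theorem stmt_14 :
    ∃ C : ℝ, 0 < C ∧
      ∀ ε δ : ℝ, 0 < ε → ε < 1 → 0 < δ → δ < 1 →
        ∀ (n t₁ t₂ : ℕ), 0 < n → 0 < t₁ → 0 < t₂ →
          ∀ (X : Fin n → Fin t₁ → ℝ) (Y : Fin n → Fin t₂ → ℝ),
            ∀ k : ℕ, C / (δ * ε ^ 2) ≤ (k : ℝ) →
              ENNReal.ofReal (1 - δ) ≤
                (Measure.pi fun _ : Fin k × Fin n => gaussianReal 0 (k : ℝ≥0)⁻¹)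
                  {S : Fin k × Fin n → ℝ |
                    (Real.sqrt (∑ c₁ : Fin t₁, ∑ c₂ : Fin t₂,
                        ((∑ i : Fin k, (∑ j : Fin n, S (i, j) * X j c₁)
                              * (∑ j : Fin n, S (i, j) * Y j c₂))
                          - ∑ j : Fin n, X j c₁ * Y j c₂) ^ 2)
                      ≤ ε * Real.sqrt (∑ j : Fin n, ∑ c₁ : Fin t₁, X j c₁ ^ 2)
                          * Real.sqrt (∑ j : Fin n, ∑ c₂ : Fin t₂, Y j c₂ ^ 2)) ∧
                    ((1 - ε) * Real.sqrt (∑ j : Fin n, ∑ c₁ : Fin t₁, X j c₁ ^ 2)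
                        ≤ Real.sqrt (∑ i : Fin k, ∑ c₁ : Fin t₁,
                            (∑ j : Fin n, S (i, j) * X j c₁) ^ 2) ∧
                      Real.sqrt (∑ i : Fin k, ∑ c₁ : Fin t₁,
                            (∑ j : Fin n, S (i, j) * X j c₁) ^ 2)
                        ≤ (1 + ε) * Real.sqrt (∑ j : Fin n, ∑ c₁ : Fin t₁, X j c₁ ^ 2)) ∧
                    ((1 - ε) * Real.sqrt (∑ j : Fin n, ∑ c₂ : Fin t₂, Y j c₂ ^ 2)
                        ≤ Real.sqrt (∑ i : Fin k, ∑ c₂ : Fin t₂,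
                            (∑ j : Fin n, S (i, j) * Y j c₂) ^ 2) ∧
                      Real.sqrt (∑ i : Fin k, ∑ c₂ : Fin t₂,
                            (∑ j : Fin n, S (i, j) * Y j c₂) ^ 2)
                        ≤ (1 + ε) * Real.sqrt (∑ j : Fin n, ∑ c₂ : Fin t₂, Y j c₂ ^ 2))} := by
  refine ⟨6, by norm_num, fun ε δ hε hε1 hδ hδ1 n t₁ t₂ _ _ _ X Y k hk ↦ ?_⟩
  have hkpos : (0 : ℝ) < k := lt_of_lt_of_le (by positivity) hk
  have hk0 : 0 < k := by exact_mod_cast hkpos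
  have hη : 2 / (k * ε ^ 2) ≤ δ / 3 := by
    rw [div_le_iff₀ (by positivity)] at hk ⊢
    linarith
  have hη' := ENNReal.ofReal_le_ofReal hη
  have b₁ := (measure_sketch_mul_error_le hk0 X Y hε).trans hη'
  have b₂ := (measure_sketch_norm_error_le hk0 X hε).trans hη'
  have b₃ := (measure_sketch_norm_error_le hk0 Y hε).trans hη'
  refine (ofReal_one_sub_le_measure_compl_union hδ.le b₁ b₂ b₃).trans (measure_mono fun S hS ↦ ?_)
  simp only [Set.compl_union, Set.mem_inter_iff, Set.mem_compl_iff,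
    Set.mem_ofPred_eq, not_lt] at hS
  obtain ⟨⟨h₁, h₂⟩, h₃⟩ := hS
  refine ⟨?_, sqrt_bounds_of_sq_sub_le hε hε1 (by positivity) h₂,
    sqrt_bounds_of_sq_sub_le hε hε1 (by positivity) h₃⟩
  refine Real.sqrt_le_iff.2 ⟨by positivity, h₁.trans_eq ?_⟩
  rw [mul_pow, mul_pow, Real.sq_sqrt (by positivity), Real.sq_sqrt (by positivity), mul_assoc]
end
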